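/- Let T be a prefix-closed tree with polarity P ⊆ T and let S ⊆ T be an odd set. Then for every node σ ∈ T of odd depth, there is at most one index i such that σ⌢i is an initial segment of some τ ∈ S. -/

import Mathlib

open scoped Classical

/-- The depth of a node `σ` of a tree with polarity `P`: the number of polarity changes
along the path from the root to `σ` (`dt ⟨⟩ = 0`, and `dt (σ⌢i) = dt σ` if `σ⌢i` and `σ`
have the same polarity, `dt σ + 1` otherwise). -/
noncomputable def dt {α : Type*} (P : Set (List α)) (σ : List α) : ℕ :=
  ((Finset.range σ.length).filter
    (fun k => ¬((σ.take (k + 1) ∈ P) ↔ (σ.take k ∈ P)))).card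

/-- A node `σ` is minimal: it lies in `T` and no proper initial segment of it has the same
depth. -/
def IsMinimal {α : Type*} (T P : Set (List α)) (σ : List α) : Prop :=
  σ ∈ T ∧ ∀ τ : List α, τ <+: σ → τ ≠ σ → dt P τ ≠ dt P σ

/-- `τ` is a minimal extension of `σ` (written `σ ⊂ₘ τ`): `σ` is an initial segment of `τ`,
both are minimal, and `dt τ = dt σ + 1`. -/
def MinExt {α : Type*} (T P : Set (List α)) (σ τ : List α) : Prop :=
  σ <+: τ ∧ IsMinimal T P σ ∧ IsMinimal T P τ ∧ dt P τ = dt P σ + 1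

/-- `S` is an odd set: (i) every element is minimal; (ii) `S` is closed under minimal
predecessors; (iii) every odd element has a unique minimal extension in `S`. -/
def OddSet {α : Type*} (T P : Set (List α)) (S : Set (List α)) : Prop :=
  (∀ σ ∈ S, IsMinimal T P σ) ∧
  (∀ σ τ : List α, MinExt T P σ τ → τ ∈ S → σ ∈ S) ∧
  (∀ σ ∈ S, Odd (dt P σ) → ∃! τ : List α, τ ∈ S ∧ MinExt T P σ τ)

section Depth

variable {α : Type*} {T P S : Set (List α)} {σ τ ρ : List α}

theorem dt_eq_card_of_prefix (h : σ <+: τ) :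
    dt P σ = ((Finset.range σ.length).filter
      (fun k => ¬((τ.take (k + 1) ∈ P) ↔ (τ.take k ∈ P)))).card := by
  obtain ⟨u, rfl⟩ := h
  unfold dt
  congr 1
  refine Finset.filter_congr fun k hk => ?_
  rw [Finset.mem_range] at hk
  rw [List.take_append_of_le_length hk, List.take_append_of_le_length hk.le]

theorem dt_mono (h : σ <+: τ) : dt P σ ≤ dt P τ := by
  rw [dt_eq_card_of_prefix h, dt]
  exact Finset.card_le_card
    (Finset.filter_subset_filter _ (Finset.range_subset_range.2 h.length_le))

theorem dt_append_singleton_le (σ : List α) (a : α) : dt P (σ ++ [a]) ≤ dt P σ + 1 := by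
  rw [dt_eq_card_of_prefix (List.prefix_append σ [a]), dt, List.length_append,
    List.length_singleton, Finset.range_add_one, Finset.filter_insert]
  split_ifs
  · exact Nat.le_succ _
  · exact Finset.card_insert_le _ _

/-- Two initial segments of the same node are ordered as their depths are. -/
theorem prefix_of_dt_lt (hσ : σ <+: τ) (hρ : ρ <+: τ) (h : dt P σ < dt P ρ) : σ <+: ρ :=
  (List.prefix_or_prefix_of_prefix hσ hρ).resolve_right fun h' => h.not_ge (dt_mono h')

/-- Every depth up to that of `τ` is attained by a minimal initial segment of `τ`. -/
theorem exists_isMinimal_prefix (hpre : ∀ p q : List α, q ∈ T → p <+: q → p ∈ T)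
    (hτ : τ ∈ T) {n : ℕ} (hn : n ≤ dt P τ) :
    ∃ ρ, ρ <+: τ ∧ IsMinimal T P ρ ∧ dt P ρ = n := by
  induction τ using List.reverseRecOn with
  | nil =>
    have h0 : dt P ([] : List α) = 0 := by simp [dt]
    exact ⟨[], List.prefix_rfl, ⟨hτ, fun ρ h hne => absurd (List.prefix_nil.1 h) hne⟩, by omega⟩
  | append_singleton l a ih =>
    have hl : l <+: l ++ [a] := List.prefix_append l [a]
    by_cases h : n ≤ dt P l
    · obtain ⟨ρ, h1, h2⟩ := ih (hpre _ _ hτ hl) h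
      exact ⟨ρ, h1.trans hl, h2⟩
    · have hle := dt_append_singleton_le (P := P) l a
      refine ⟨l ++ [a], List.prefix_rfl, ⟨hτ, fun ρ hρ hne => ?_⟩, by omega⟩
      have := dt_mono (P := P) ((List.prefix_concat_iff.1 hρ).resolve_left hne)
      omega

/-- An odd set contains every minimal initial segment of each of its elements. -/
theorem OddSet.mem_of_prefix {ρ : List α} (hpre : ∀ p q : List α, q ∈ T → p <+: q → p ∈ T)
    (hS : OddSet T P S) (hτ : τ ∈ S) (hρ : IsMinimal T P ρ) (h : ρ <+: τ) : ρ ∈ S := by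
  have hmin := hS.1 τ hτ
  by_cases hne : ρ = τ
  · exact hne ▸ hτ
  have hlt : dt P ρ < dt P τ := lt_of_le_of_ne (dt_mono h) (hmin.2 ρ h hne)
  obtain ⟨ρ', h1, h2, h3⟩ := exists_isMinimal_prefix hpre hmin.1 (Nat.succ_le_of_lt hlt)
  exact hS.2.1 ρ ρ' ⟨prefix_of_dt_lt (P := P) h h1 (by omega), hρ, h2, h3⟩
    (OddSet.mem_of_prefix hpre hS hτ h2 h1)
termination_by dt P τ - dt P ρ
decreasing_by omega

/-- An element of an odd set properly extending `σ` extends `σ` through a minimal extension,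
in the odd set, of any minimal initial segment of `σ` of the same depth. -/
theorem OddSet.exists_minExt (hpre : ∀ p q : List α, q ∈ T → p <+: q → p ∈ T)
    (hS : OddSet T P S) (hρ : IsMinimal T P ρ) (hρσ : ρ <+: σ) (hd : dt P ρ = dt P σ)
    {a : α} (hτ : τ ∈ S) (h : σ ++ [a] <+: τ) :
    ρ ∈ S ∧ ∃ τ' ∈ S, MinExt T P ρ τ' ∧ σ ++ [a] <+: τ' := by
  have hmin := hS.1 τ hτ
  have hστ : σ <+: τ := (List.prefix_append σ [a]).trans h
  have hne : σ ≠ τ := by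
    rintro rfl
    simpa using h.length_le
  have hlt : dt P σ < dt P τ := lt_of_le_of_ne (dt_mono hστ) (hmin.2 σ hστ hne)
  obtain ⟨τ', h1, h2, h3⟩ := exists_isMinimal_prefix hpre hmin.1 (Nat.succ_le_of_lt hlt)
  have hστ' : σ <+: τ' := prefix_of_dt_lt (P := P) hστ h1 (by omega)
  refine ⟨hS.mem_of_prefix hpre hτ hρ (hρσ.trans hστ), τ', hS.mem_of_prefix hpre hτ h2 h1,
    ⟨hρσ.trans hστ', hρ, h2, by omega⟩, ?_⟩
  rcases List.prefix_or_prefix_of_prefix h h1 with h' | h'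
  · exact h'
  · rcases List.prefix_concat_iff.1 h' with h'' | h''
    · exact h'' ▸ List.prefix_rfl
    · have := dt_mono (P := P) h''
      omega

end Depth


/-- If `S ⊆ T` is an odd set, then for every node `σ ∈ T` of odd depth
there is at most one index `a` such that `σ⌢a` is an initial segment of some `τ ∈ S`. -/
theorem oddSet_at_most_one_child {α : Type*} (T P : Set (List α))
    (hpre : ∀ p q : List α, q ∈ T → p <+: q → p ∈ T) (hP : P ⊆ T)
    (S : Set (List α)) (hS : S ⊆ T) (hodd : OddSet T P S)
    (σ : List α) (hσ : σ ∈ T) (hdt : Odd (dt P σ)) :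
    ∀ a b : α, (∃ τ ∈ S, (σ ++ [a]) <+: τ) → (∃ τ ∈ S, (σ ++ [b]) <+: τ) → a = b := by
  rintro a b ⟨τ₁, hτ₁, h₁⟩ ⟨τ₂, hτ₂, h₂⟩
  obtain ⟨ρ, hρσ, hρ, hd⟩ := exists_isMinimal_prefix hpre hσ (le_refl (dt P σ))
  obtain ⟨hρS, ρ₁, hρ₁, hm₁, hp₁⟩ := hodd.exists_minExt hpre hρ hρσ hd hτ₁ h₁
  obtain ⟨-, ρ₂, hρ₂, hm₂, hp₂⟩ := hodd.exists_minExt hpre hρ hρσ hd hτ₂ h₂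
  obtain rfl := (hodd.2.2 ρ hρS (hd ▸ hdt)).unique ⟨hρ₁, hm₁⟩ ⟨hρ₂, hm₂⟩
  have := List.prefix_of_prefix_length_le hp₁ hp₂ (by simp)
  simpa using this
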